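/- arXiv:1802.04896 — 4 statements merged into one kernel-verified Lean document; each statement's English description precedes it below -/
import Mathlib

section
/- Let B be a commutative integral domain equipped with an ℕ-grading B = ⊕_{m≥0} B_m, and let A ⊆ B be a subring containing B_0 such that there exists n ∈ ℕ with B_m ⊆ A for every m > n. Assume B contains a nonzero homogeneous element of positive degree. Then the conductor is nonzero: there exists a nonzero element a ∈ A such that a·b ∈ A for every b ∈ B. -/
/-- Let `B` be a commutative integral domain with an internal ℕ-grading
`B = ⊕_{m ≥ 0} B_m`, and let `A ⊆ B` be a subring containing `B_0` such that
there is `n : ℕ` with `B_m ⊆ A` for every `m > n`.  If `B` contains a nonzero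
homogeneous element of positive degree, then the conductor is nonzero: there
is a nonzero `a ∈ A` such that `a * b ∈ A` for all `b ∈ B`. -/
theorem graded_subring_cofinal_degrees_conductor_ne_zero
    {B : Type*} [CommRing B] [IsDomain B]
    (𝒜 : ℕ → AddSubgroup B) [GradedRing 𝒜]
    (A : Subring B)
    (h0 : (𝒜 0 : Set B) ⊆ (A : Set B))
    (hcofinal : ∃ n : ℕ, ∀ m : ℕ, n < m → (𝒜 m : Set B) ⊆ (A : Set B))
    (hpos : ∃ d : ℕ, 1 ≤ d ∧ ∃ b₀ ∈ 𝒜 d, b₀ ≠ 0) :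
    ∃ a ∈ A, a ≠ 0 ∧ ∀ b : B, a * b ∈ A := by
  obtain ⟨n, hn⟩ := hcofinal
  obtain ⟨d, hd, b₀, hb₀, hne⟩ := hpos
  have hmem : b₀ ^ (n + 1) ∈ 𝒜 ((n + 1) * d) := by
    simpa only [smul_eq_mul] using SetLike.pow_mem_graded (n + 1) hb₀
  have hdeg : n < (n + 1) * d := by nlinarith
  refine ⟨b₀ ^ (n + 1), hn _ hdeg hmem, pow_ne_zero _ hne, fun b => ?_⟩
  induction b using DirectSum.Decomposition.inductionOn 𝒜 with
  | zero => simp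
  | @homogeneous i x =>
    exact hn ((n + 1) * d + i) (by lia) (SetLike.mul_mem_graded hmem x.2)
  | add x y hx hy => simpa only [mul_add] using A.add_mem hx hy
end

section
/- Let B be a commutative integral domain equipped with an ℕ-grading B = ⊕_{m≥0} B_m, and let A ⊆ B be a subring containing B_0 such that there exists n ∈ ℕ with B_m ⊆ A for every m > n. Assume B contains a nonzero homogeneous element of positive degree. Then the inclusion A ⊆ B induces an isomorphism of fraction fields; concretely, the induced map from the fraction field of A to the fraction field of B is bijective (equivalently, the fraction field of B is a fraction field of A, i.e. every element of Frac(B) can be written as a quotient a/a' with a, a' ∈ A, a' ≠ 0). -/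
/-- If a subring contains all homogeneous elements of degree greater than `n`, then it contains
every multiple of such an element. -/
theorem Subring.mul_mem_of_mem_graded_of_lt {B : Type*} [CommRing B]
    (𝒜 : ℕ → AddSubgroup B) [GradedRing 𝒜] (A : Subring B) {n : ℕ}
    (hA : ∀ m : ℕ, n < m → (𝒜 m : Set B) ⊆ (A : Set B))
    {k : ℕ} (hk : n < k) {s : B} (hs : s ∈ 𝒜 k) (b : B) : s * b ∈ A := by
  induction b using DirectSum.Decomposition.inductionOn 𝒜 with
  | zero => simp
  | homogeneous c => exact hA _ (by omega) (SetLike.mul_mem_graded hs c.2)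
  | add b c hb hc => simpa only [mul_add] using A.add_mem hb hc

/-- Let `B` be a commutative integral domain with an internal ℕ-grading
`B = ⊕_{m ≥ 0} B_m`, and let `A ⊆ B` be a subring containing `B_0` such that
there is `n : ℕ` with `B_m ⊆ A` for every `m > n`.  If `B` contains a nonzero
homogeneous element of positive degree, then the inclusion `A ⊆ B` induces an
isomorphism of fraction fields: every element of `Frac(B)` is a quotient
`a / a'` of elements `a, a' ∈ A` with `a' ≠ 0`. -/
theorem graded_subring_cofinal_degrees_fractionField_eq
    {B : Type*} [CommRing B] [IsDomain B]
    (𝒜 : ℕ → AddSubgroup B) [GradedRing 𝒜]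
    (A : Subring B)
    (h0 : (𝒜 0 : Set B) ⊆ (A : Set B))
    (hcofinal : ∃ n : ℕ, ∀ m : ℕ, n < m → (𝒜 m : Set B) ⊆ (A : Set B))
    (hpos : ∃ d : ℕ, 1 ≤ d ∧ ∃ b₀ ∈ 𝒜 d, b₀ ≠ 0) :
    ∀ x : FractionRing B, ∃ a a' : A, (a' : B) ≠ 0 ∧
      x = algebraMap B (FractionRing B) (a : B) /
          algebraMap B (FractionRing B) (a' : B) := by
  obtain ⟨n, hA⟩ := hcofinal
  obtain ⟨d, hd, b₀, hb₀, hne⟩ := hpos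
  have hs : b₀ ^ (n + 1) ∈ 𝒜 ((n + 1) * d) := by
    simpa using SetLike.pow_mem_graded (n + 1) hb₀
  have hs_ne : b₀ ^ (n + 1) ≠ 0 := pow_ne_zero _ hne
  have hmem := A.mul_mem_of_mem_graded_of_lt 𝒜 hA (by nlinarith) hs
  intro x
  obtain ⟨p, q, hq, rfl⟩ := IsFractionRing.div_surjective (A := B) x
  refine ⟨⟨_, hmem p⟩, ⟨_, hmem q⟩, mul_ne_zero hs_ne (nonZeroDivisors.ne_zero hq), ?_⟩
  have hs_map : algebraMap B (FractionRing B) (b₀ ^ (n + 1)) ≠ 0 := by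
    rwa [Ne, FaithfulSMul.algebraMap_eq_zero_iff]
  simp only [map_mul]
  rw [mul_div_mul_left _ _ hs_map]
end

section
/- Let B be a commutative integral domain equipped with an ℕ-grading B = ⊕_{m≥0} B_m, and let A ⊆ B be a subring containing B_0 such that there exists n ∈ ℕ with B_m ⊆ A for every m > n. If A is integrally closed in its fraction field (i.e. A is a normal domain), then A = B. Equivalently, if A ≠ B then A is not integrally closed, i.e. A is a non-normal domain. -/
/-- An integrally closed subring of a domain contains `b` as soon as it contains
`b ^ k` and `b ^ (k + 1)` for some `k ≠ 0`. -/
theorem Subring.mem_of_pow_mem_of_pow_succ_mem {B : Type*} [CommRing B] [IsDomain B]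
    {A : Subring B} [IsIntegrallyClosed A] {b : B} {k : ℕ} (hk : k ≠ 0)
    (h : b ^ k ∈ A) (h' : b ^ (k + 1) ∈ A) : b ∈ A := by
  rcases eq_or_ne b 0 with rfl | hb
  · exact A.zero_mem
  have hdvd : (⟨b ^ k, h⟩ : A) ^ k ∣ (⟨b ^ (k + 1), h'⟩ : A) ^ k :=
    ⟨⟨b ^ k, h⟩, Subtype.ext <| by
      simp only [SubmonoidClass.mk_pow, MulMemClass.mk_mul_mk]
      ring⟩
  obtain ⟨c, hc⟩ := (IsIntegrallyClosed.pow_dvd_pow_iff hk).mp hdvd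
  have hbc : b ^ k * b = b ^ k * c := by
    simpa [pow_succ] using congrArg Subtype.val hc
  rw [mul_left_cancel₀ (pow_ne_zero k hb) hbc]
  exact c.2

/-- Let `B` be a commutative integral domain with an internal ℕ-grading
`B = ⊕_{m ≥ 0} B_m`, and let `A ⊆ B` be a subring containing `B_0` such that
there is `n : ℕ` with `B_m ⊆ A` for every `m > n`.  If `A` is integrally
closed in its fraction field (`A` is a normal domain), then `A = B`. -/
theorem graded_subring_cofinal_degrees_integrallyClosed_eq_top
    {B : Type*} [CommRing B] [IsDomain B]
    (𝒜 : ℕ → AddSubgroup B) [GradedRing 𝒜]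
    (A : Subring B)
    (h0 : (𝒜 0 : Set B) ⊆ (A : Set B))
    (hcofinal : ∃ n : ℕ, ∀ m : ℕ, n < m → (𝒜 m : Set B) ⊆ (A : Set B))
    (hA : IsIntegrallyClosed A) :
    A = ⊤ := by
  classical
  obtain ⟨n, hn⟩ := hcofinal
  refine (Subring.eq_top_iff' A).mpr fun x => ?_
  rw [← DirectSum.sum_support_decompose 𝒜 x]
  refine A.sum_mem fun m _ => ?_
  rcases Nat.eq_zero_or_pos m with rfl | hm
  · exact h0 (DirectSum.decompose 𝒜 x 0).2
  have hpow (k : ℕ) (hk : n < k) : (DirectSum.decompose 𝒜 x m : B) ^ k ∈ A :=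
    hn (k • m) (hk.trans_le (Nat.le_mul_of_pos_right k hm))
      (SetLike.pow_mem_graded k (DirectSum.decompose 𝒜 x m).2)
  exact Subring.mem_of_pow_mem_of_pow_succ_mem n.succ_ne_zero
    (hpow _ n.lt_succ_self) (hpow _ (by lia))
end

section
/- Let B be a commutative integral domain equipped with an ℕ-grading B = ⊕_{m≥0} B_m, and let A ⊆ B be a subring containing B_0 such that there exists n ∈ ℕ with B_m ⊆ A for every m > n. If B is integrally closed in its fraction field (i.e. B is a normal domain), then B is the integral closure of A in the fraction field of B; that is, an element x of Frac(B) is integral over A if and only if x ∈ B. -/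
/-- A graded ring is integral over every subring containing its degree-zero part and all homogeneous
parts of sufficiently large degree. -/
theorem GradedRing.isIntegral_of_cofinal_degrees_subset
    {B : Type*} [CommRing B] (𝒜 : ℕ → AddSubgroup B) [GradedRing 𝒜] (A : Subring B)
    (h0 : (𝒜 0 : Set B) ⊆ (A : Set B))
    (hcofinal : ∃ n : ℕ, ∀ m : ℕ, n < m → (𝒜 m : Set B) ⊆ (A : Set B)) :
    Algebra.IsIntegral A B := by
  classical
  obtain ⟨n, hn⟩ := hcofinal
  refine ⟨fun b => ?_⟩
  rw [← DirectSum.sum_support_decompose 𝒜 b]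
  refine IsIntegral.sum _ fun m _ => ?_
  have hb : (DirectSum.decompose 𝒜 b m : B) ∈ 𝒜 m := SetLike.coe_mem _
  generalize (DirectSum.decompose 𝒜 b m : B) = c at hb
  rcases Nat.eq_zero_or_pos m with rfl | hm
  · exact isIntegral_algebraMap (x := (⟨c, h0 hb⟩ : A))
  · have hc : c ^ (n + 1) ∈ 𝒜 ((n + 1) • m) := SetLike.pow_mem_graded (n + 1) hb
    have hlt : n < (n + 1) • m := by
      rw [smul_eq_mul]
      exact Nat.lt_of_succ_le (Nat.le_mul_of_pos_right _ hm)
    exact IsIntegral.of_pow n.succ_pos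
      (isIntegral_algebraMap (x := (⟨c ^ (n + 1), hn _ hlt hc⟩ : A)))

/-- Let `B` be a commutative integral domain with an internal ℕ-grading
`B = ⊕_{m ≥ 0} B_m`, and let `A ⊆ B` be a subring containing `B_0` such that
there is `n : ℕ` with `B_m ⊆ A` for every `m > n`.  If `B` is integrally
closed in its fraction field, then `B` is the integral closure of `A` in
`Frac(B)`: an element `x` of `Frac(B)` is integral over `A` (via the composite
map `A → B → Frac(B)`) if and only if `x` lies in the image of `B`. -/
theorem graded_subring_cofinal_degrees_integralClosure_eq
    {B : Type*} [CommRing B] [IsDomain B]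
    (𝒜 : ℕ → AddSubgroup B) [GradedRing 𝒜]
    (A : Subring B)
    (h0 : (𝒜 0 : Set B) ⊆ (A : Set B))
    (hcofinal : ∃ n : ℕ, ∀ m : ℕ, n < m → (𝒜 m : Set B) ⊆ (A : Set B))
    (hB : IsIntegrallyClosed B) :
    ∀ x : FractionRing B,
      ((algebraMap B (FractionRing B)).comp A.subtype).IsIntegralElem x ↔
        ∃ b : B, algebraMap B (FractionRing B) b = x := by
  have hAB : Algebra.IsIntegral A B :=
    GradedRing.isIntegral_of_cofinal_degrees_subset 𝒜 A h0 hcofinal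
  intro x
  constructor
  · intro hx
    exact IsIntegrallyClosed.isIntegral_iff.mp
      (RingHom.IsIntegralElem.of_comp (f := A.subtype) hx)
  · rintro ⟨b, rfl⟩
    obtain ⟨p, hp, hpb⟩ := hAB.isIntegral b
    refine ⟨p, hp, ?_⟩
    rw [← Polynomial.hom_eval₂]
    exact (congrArg _ hpb).trans (map_zero _)
end
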